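/- Entropic Rogers–Shephard inequality for convex measures: let κ < 0 and suppose (X, Y) ∈ ℝ^d × ℝ^d has a κ-concave joint distribution with X and Y independent and identically distributed, each with density. Then N(X−Y) ≤ C_κ N(X), where C_κ = exp{ (2/d)(1−dκ) Σ_{j=0}^{d−1} 1/(1−jκ) }. -/

import Mathlib

open MeasureTheory ProbabilityTheory Real
open scoped ENNReal Pointwise Classical

noncomputable section

/-- The random vector `X` has density `f` with respect to Lebesgue measure on `ℝ^d`. -/
def HasDensityFn {Ω : Type*} [MeasurableSpace Ω] {d : ℕ}
    (P : Measure Ω) (X : Ω → (Fin d → ℝ)) (f : (Fin d → ℝ) → ℝ) : Prop :=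
  Measurable X ∧ Measurable f ∧ (∀ x, 0 ≤ f x) ∧
    Measure.map X P = volume.withDensity (fun x => ENNReal.ofReal (f x))

/-- Shannon (differential) entropy of a density `f` on `ℝ^d`: `h(f) = -∫ f log f`. -/
def shannonEntropy (d : ℕ) (f : (Fin d → ℝ) → ℝ) : ℝ :=
  -∫ x, f x * Real.log (f x)

/-- Entropy power `N(f) = exp(2 h(f) / d)`. -/
def entropyPower (d : ℕ) (f : (Fin d → ℝ) → ℝ) : ℝ :=
  Real.exp (2 * shannonEntropy d f / d)

/-- The generalized `κ`-mean `M_κ^t(a,b)` for `κ ∈ [-∞, ∞]`. -/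
def genMean (κ : EReal) (t a b : ℝ) : ℝ :=
  if κ = ⊥ then min a b
  else if κ = ⊤ then max a b
  else if κ = 0 then a ^ (1 - t) * b ^ t
  else if κ.toReal < 0 ∧ (a = 0 ∨ b = 0) then 0
  else ((1 - t) * a ^ κ.toReal + t * b ^ κ.toReal) ^ (1 / κ.toReal)

/-- A measure `μ` on a real topological vector space is `κ`-concave in the sense of
Borell: its support has nonempty interior and
`μ((1-t)A + tB) ≥ M_κ^t(μ(A), μ(B))` for all Borel `A, B` and `t ∈ [0,1]`. -/
def IsKappaConcave {E : Type*} [AddCommGroup E] [Module ℝ E] [TopologicalSpace E]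
    [MeasurableSpace E] (κ : EReal) (μ : Measure E) : Prop :=
  (interior {x : E | ∀ U ∈ nhds x, 0 < μ U}).Nonempty ∧
    ∀ A B : Set E, MeasurableSet A → MeasurableSet B → ∀ t : ℝ, t ∈ Set.Icc (0:ℝ) 1 →
      genMean κ t (μ A).toReal (μ B).toReal ≤ (μ ((1 - t) • A + t • B)).toReal

/-- One-dimensional Brunn–Minkowski for compact sets. -/
lemma bm_compact (K L : Set ℝ) (hK : IsCompact K) (hL : IsCompact L) (hKn : K.Nonempty)
    (hLn : L.Nonempty) : volume K + volume L ≤ volume (K + L) := by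
  set a := sSup K
  set b := sInf L
  have ha : a ∈ K := hK.sSup_mem hKn
  have hb : b ∈ L := hL.sInf_mem hLn
  have h1 : volume ((fun x => x + b) '' K) = volume K := by
    simp
  have h2 : volume ((fun x => a + x) '' L \ {a + b}) = volume L := by
    rw [measure_sdiff_null (by simp)]
    simp
  have hdisj : Disjoint ((fun x => x + b) '' K) ((fun x => a + x) '' L \ {a + b}) := by
    rw [Set.disjoint_left]
    rintro _ ⟨x, hx, rfl⟩ ⟨⟨y, hy, hxy⟩, hne⟩
    have h3 : x ≤ a := le_csSup hK.bddAbove hx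
    have h4 : b ≤ y := csInf_le hL.bddBelow hy
    simp only [Set.mem_singleton_iff] at hne hxy
    apply hne
    linarith
  have hmeas : MeasurableSet ((fun x => a + x) '' L \ {a + b}) :=
    ((hL.image (by fun_prop)).measurableSet).diff (measurableSet_singleton _)
  rw [← h1, ← h2, ← measure_union hdisj hmeas]
  apply measure_mono
  rintro z (⟨x, hx, rfl⟩ | ⟨⟨y, hy, rfl⟩, -⟩)
  · exact Set.add_mem_add hx hb
  · exact Set.add_mem_add ha hy

lemma bm_half (A B C : Set ℝ) (hA : MeasurableSet A) (hB : MeasurableSet B)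
    (hAn : A.Nonempty) (hBn : B.Nonempty)
    (hC : ∀ x ∈ A, ∀ y ∈ B, (x + y) / 2 ∈ C) :
    volume A + volume B ≤ 2 * volume C := by
  obtain ⟨a, ha⟩ := hAn
  obtain ⟨b, hb⟩ := hBn
  have key : ∀ K ⊆ A, ∀ L ⊆ B, IsCompact K → IsCompact L →
      volume K + volume L ≤ 2 * volume C := by
    intro K hKA L hLB hK hL
    have h := bm_compact (insert a K) (insert b L) (hK.insert a) (hL.insert b)
      (Set.insert_nonempty _ _) (Set.insert_nonempty _ _)
    have h2 : insert a K + insert b L ⊆ (2:ℝ) • C := by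
      rintro _ ⟨x, hx, y, hy, rfl⟩
      have hx' : x ∈ A := Set.insert_subset ha hKA hx
      have hy' : y ∈ B := Set.insert_subset hb hLB hy
      exact ⟨(x + y) / 2, hC x hx' y hy', by simp; ring⟩
    calc volume K + volume L ≤ volume (insert a K) + volume (insert b L) := by
          gcongr <;> exact Set.subset_insert _ _
      _ ≤ _ := h
      _ ≤ volume ((2:ℝ) • C) := measure_mono h2
      _ = 2 * volume C := by
          rw [Measure.addHaar_smul]; simp
  have key2 : ∀ K ⊆ A, IsCompact K → volume K + volume B ≤ 2 * volume C := by
    intro K hKA hK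
    have h : volume B ≤ 2 * volume C - volume K := by
      rw [hB.measure_eq_iSup_isCompact]
      refine iSup_le fun L => iSup_le fun hLB => iSup_le fun hL => ?_
      exact ENNReal.le_sub_of_add_le_left hK.measure_lt_top.ne (key K hKA L hLB hK hL)
    have h2 : volume K ≤ 2 * volume C :=
      le_trans le_self_add (key K hKA ∅ (Set.empty_subset _) hK isCompact_empty)
    calc volume K + volume B ≤ volume K + (2 * volume C - volume K) := by gcongr
      _ = 2 * volume C := add_tsub_cancel_of_le h2
  have hB2 : volume B ≤ 2 * volume C := by
    simpa using key2 ∅ (Set.empty_subset _) isCompact_empty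
  by_cases hBt : volume B = ∞
  · rw [hBt] at hB2
    rw [top_le_iff.mp hB2]
    exact le_top
  have h : volume A ≤ 2 * volume C - volume B := by
    rw [hA.measure_eq_iSup_isCompact]
    refine iSup_le fun K => iSup_le fun hKA => iSup_le fun hK => ?_
    exact ENNReal.le_sub_of_add_le_right hBt (key2 K hKA hK)
  calc volume A + volume B ≤ (2 * volume C - volume B) + volume B := by gcongr
    _ = 2 * volume C := tsub_add_cancel_of_le hB2

lemma pl_norm (u v h : ℝ → ℝ) (hu : Measurable u) (hv : Measurable v) (hh : Measurable h)
    (hu0 : ∀ x, 0 ≤ u x) (hv0 : ∀ x, 0 ≤ v x) (hh0 : ∀ x, 0 ≤ h x)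
    (hu1 : ∀ x, u x ≤ 1) (hv1 : ∀ x, v x ≤ 1)
    (hu2 : ∀ t < 1, ∃ x, t < u x) (hv2 : ∀ t < 1, ∃ x, t < v x)
    (H : ∀ x y, u x * v y ≤ h ((x + y) / 2) ^ 2) :
    (∫⁻ x, ENNReal.ofReal (u x)) + ∫⁻ x, ENNReal.ofReal (v x) ≤
      2 * ∫⁻ x, ENNReal.ofReal (h x) := by
  rw [lintegral_eq_lintegral_meas_lt volume (.of_forall hu0) hu.aemeasurable,
    lintegral_eq_lintegral_meas_lt volume (.of_forall hv0) hv.aemeasurable,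
    lintegral_eq_lintegral_meas_lt volume (.of_forall hh0) hh.aemeasurable,
    ← lintegral_const_mul' _ _ (by simp), ← lintegral_add_left]
  · refine setLIntegral_mono' measurableSet_Ioi fun t ht => ?_
    rw [Set.mem_Ioi] at ht
    by_cases ht1 : t < 1
    · refine bm_half _ _ _ (measurableSet_lt measurable_const hu)
        (measurableSet_lt measurable_const hv) (hu2 t ht1) (hv2 t ht1) ?_
      intro x hx y hy
      simp only [Set.mem_ofPred_eq] at hx hy ⊢
      refine lt_of_pow_lt_pow_left₀ 2 (hh0 _) (lt_of_lt_of_le ?_ (H x y))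
      nlinarith
    · have h1 : {a | t < u a} = ∅ := by
        ext x; simp only [Set.mem_ofPred_eq, Set.mem_empty_iff_false, iff_false]
        linarith [hu1 x]
      have h2 : {a | t < v a} = ∅ := by
        ext x; simp only [Set.mem_ofPred_eq, Set.mem_empty_iff_false, iff_false]
        linarith [hv1 x]
      simp [h1, h2]
  · have : Antitone fun t => volume {a | t < u a} := fun s t hst =>
      measure_mono fun x hx => lt_of_le_of_lt hst hx
    exact this.measurable

lemma pl_one (u v h : ℝ → ℝ) (hu : Measurable u) (hv : Measurable v) (hh : Measurable h)
    (hu0 : ∀ x, 0 ≤ u x) (hv0 : ∀ x, 0 ≤ v x) (hh0 : ∀ x, 0 ≤ h x)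
    (hu1 : BddAbove (Set.range u)) (hv1 : BddAbove (Set.range v))
    (H : ∀ x y, u x * v y ≤ h ((x + y) / 2) ^ 2) :
    (∫⁻ x, ENNReal.ofReal (u x)) * ∫⁻ x, ENNReal.ofReal (v x) ≤
      (∫⁻ x, ENNReal.ofReal (h x)) ^ 2 := by
  set a := ⨆ x, u x with ha
  set b := ⨆ x, v x with hb
  have hua : ∀ x, u x ≤ a := le_ciSup hu1
  have hvb : ∀ x, v x ≤ b := le_ciSup hv1
  rcases (le_trans (hu0 0) (hua 0)).eq_or_lt with ha0 | ha0
  · have : ∀ x, u x = 0 := fun x => le_antisymm (ha0 ▸ hua x) (hu0 x)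
    simp [this]
  rcases (le_trans (hv0 0) (hvb 0)).eq_or_lt with hb0 | hb0
  · have : ∀ x, v x = 0 := fun x => le_antisymm (hb0 ▸ hvb x) (hv0 x)
    simp [this]
  have key := pl_norm (fun x => a⁻¹ * u x) (fun x => b⁻¹ * v x) (fun x => (√(a * b))⁻¹ * h x)
    (by fun_prop) (by fun_prop) (by fun_prop)
    (fun x => mul_nonneg (by positivity) (hu0 x)) (fun x => mul_nonneg (by positivity) (hv0 x))
    (fun x => mul_nonneg (by positivity) (hh0 x))
    (fun x => by rw [inv_mul_le_iff₀ ha0]; simpa using hua x)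
    (fun x => by rw [inv_mul_le_iff₀ hb0]; simpa using hvb x)
    (fun t ht => by
      obtain ⟨x, hx⟩ := exists_lt_of_lt_ciSup (show a * t < ⨆ x, u x by nlinarith)
      exact ⟨x, by rwa [lt_inv_mul_iff₀ ha0]⟩)
    (fun t ht => by
      obtain ⟨x, hx⟩ := exists_lt_of_lt_ciSup (show b * t < ⨆ x, v x by nlinarith)
      exact ⟨x, by rwa [lt_inv_mul_iff₀ hb0]⟩)
    (fun x y => by
      rw [mul_pow, inv_pow, Real.sq_sqrt (by positivity)]
      calc a⁻¹ * u x * (b⁻¹ * v y) = (a * b)⁻¹ * (u x * v y) := by field_simp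
        _ ≤ _ := by gcongr; exact H x y)
  simp only [ENNReal.ofReal_mul (inv_nonneg.mpr ha0.le), ENNReal.ofReal_mul (inv_nonneg.mpr hb0.le),
    ENNReal.ofReal_mul (inv_nonneg.mpr (Real.sqrt_nonneg (a * b)))] at key
  rw [lintegral_const_mul' _ _ (by simp), lintegral_const_mul' _ _ (by simp),
    lintegral_const_mul' _ _ (by simp)] at key
  generalize (∫⁻ x, ENNReal.ofReal (u x)) = p at *
  generalize (∫⁻ x, ENNReal.ofReal (v x)) = q at *
  generalize (∫⁻ x, ENNReal.ofReal (h x)) = r at *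
  by_cases hr : r = ∞
  · simp [hr]
  lift r to NNReal using hr
  have hfin : ENNReal.ofReal a⁻¹ * p + ENNReal.ofReal b⁻¹ * q < ∞ :=
    lt_of_le_of_lt key (by finiteness)
  have hp : p ≠ ∞ := by
    rintro rfl
    rw [ENNReal.mul_top (by simpa using ha0)] at hfin
    simp at hfin
  have hq : q ≠ ∞ := by
    rintro rfl
    rw [ENNReal.mul_top (by simpa using hb0)] at hfin
    simp at hfin
  lift p to NNReal using hp
  lift q to NNReal using hq
  have key2 := ENNReal.toReal_mono (by finiteness) key
  rw [ENNReal.toReal_add (by finiteness) (by finiteness)] at key2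
  simp only [ENNReal.toReal_mul, ENNReal.toReal_ofReal (inv_nonneg.mpr ha0.le),
    ENNReal.toReal_ofReal (inv_nonneg.mpr hb0.le), ENNReal.coe_toReal,
    ENNReal.toReal_ofReal (inv_nonneg.mpr (Real.sqrt_nonneg (a * b))), ENNReal.toReal_ofNat] at key2
  norm_cast
  rw [← NNReal.coe_le_coe]
  push_cast
  have h1 : (a⁻¹ * p + b⁻¹ * q) ^ 2 ≤ (2 * ((√(a * b))⁻¹ * (r:ℝ))) ^ 2 := by gcongr
  have h2 : (2 * ((√(a * b))⁻¹ * (r:ℝ))) ^ 2 = 4 * ((a * b)⁻¹ * (r:ℝ) ^ 2) := by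
    rw [mul_pow, mul_pow, inv_pow, Real.sq_sqrt (by positivity)]; norm_num
  have h3 : 4 * ((a⁻¹ * p) * (b⁻¹ * q)) ≤ (a⁻¹ * p + b⁻¹ * q) ^ 2 := by
    nlinarith [sq_nonneg (a⁻¹ * p - b⁻¹ * q)]
  have h4 : (a * b)⁻¹ * ((p:ℝ) * q) ≤ (a * b)⁻¹ * (r:ℝ) ^ 2 := by
    have : (a⁻¹ * p) * (b⁻¹ * q) = (a * b)⁻¹ * ((p:ℝ) * q) := by field_simp
    linarith
  exact le_of_mul_le_mul_left h4 (by positivity)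

/-- Prékopa–Leindler for a measure satisfying midpoint log-concavity. -/
lemma pl_measure {E : Type*} [AddCommGroup E] [Module ℝ E] [MeasurableSpace E]
    (μ : Measure E) [IsProbabilityMeasure μ]
    (hμ : ∀ A B C : Set E, MeasurableSet A → MeasurableSet B →
      (∀ x ∈ A, ∀ y ∈ B, (1 / 2 : ℝ) • (x + y) ∈ C) → μ A * μ B ≤ μ C ^ 2)
    (p q m : E → ℝ) (hp : Measurable p) (hq : Measurable q) (hm : Measurable m)
    (hp0 : ∀ x, 0 ≤ p x) (hq0 : ∀ x, 0 ≤ q x) (hm0 : ∀ x, 0 ≤ m x)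
    (hp1 : ∀ x, p x ≤ 1) (hq1 : ∀ x, q x ≤ 1)
    (H : ∀ x y, p x * q y ≤ m ((1 / 2 : ℝ) • (x + y)) ^ 2) :
    (∫⁻ x, ENNReal.ofReal (p x) ∂μ) * ∫⁻ x, ENNReal.ofReal (q x) ∂μ ≤
      (∫⁻ x, ENNReal.ofReal (m x) ∂μ) ^ 2 := by
  have trans : ∀ w : E → ℝ, Measurable w → (∀ x, 0 ≤ w x) →
      ∫⁻ x, ENNReal.ofReal (w x) ∂μ =
        ∫⁻ s, ENNReal.ofReal (exp s * μ.real {x | exp s < w x}) := by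
    intro w hw hw0
    rw [lintegral_eq_lintegral_meas_lt μ (.of_forall hw0) hw.aemeasurable]
    have := lintegral_image_eq_lintegral_abs_deriv_mul (s := Set.univ) (f := exp) (f' := exp)
      MeasurableSet.univ (fun x _ => (Real.hasDerivAt_exp x).hasDerivWithinAt)
      (Real.exp_injective.injOn) (fun t => μ {a | t < w a})
    rw [Set.image_univ, Real.range_exp, setLIntegral_univ] at this
    rw [this]
    congr with s
    rw [abs_of_pos (exp_pos s), ENNReal.ofReal_mul (exp_pos s).le, ofReal_measureReal]
  have hmeas : ∀ w : E → ℝ, Measurable fun s => exp s * μ.real {x | exp s < w x} := by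
    intro w
    have : Antitone fun s => μ.real {x | exp s < w x} := fun s t hst =>
      measureReal_mono fun x hx => lt_of_le_of_lt (exp_le_exp.mpr hst) hx
    exact measurable_exp.mul this.measurable
  have hbdd : ∀ w : E → ℝ, (∀ x, w x ≤ 1) →
      BddAbove (Set.range fun s => exp s * μ.real {x | exp s < w x}) := by
    intro w hw1
    refine ⟨1, ?_⟩
    rintro _ ⟨s, rfl⟩
    by_cases hs : s < 0
    · have h1 : exp s ≤ 1 := by simpa using hs.le
      have h2 : μ.real {x | exp s < w x} ≤ 1 := measureReal_le_one
      exact mul_le_one₀ h1 measureReal_nonneg h2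
    · have h1 : 1 ≤ exp s := by simpa using hs
      have : {x | exp s < w x} = ∅ := by
        ext x; simp only [Set.mem_ofPred_eq, Set.mem_empty_iff_false, iff_false]
        linarith [hw1 x]
      simp [this]
  rw [trans p hp hp0, trans q hq hq0, trans m hm hm0]
  refine pl_one _ _ _ (hmeas p) (hmeas q) (hmeas m) (fun _ => by positivity) (fun _ => by positivity)
    (fun _ => by positivity) (hbdd p hp1) (hbdd q hq1) ?_
  intro s t
  have h := hμ {x | exp s < p x} {x | exp t < q x} {x | exp ((s + t) / 2) < m x}
    (measurableSet_lt measurable_const hp) (measurableSet_lt measurable_const hq) (by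
      intro x hx y hy
      simp only [Set.mem_ofPred_eq] at hx hy ⊢
      refine lt_of_pow_lt_pow_left₀ 2 (hm0 _) (lt_of_lt_of_le ?_ (H x y))
      rw [← exp_nat_mul]
      have : exp ((2:ℕ) * ((s + t) / 2)) = exp s * exp t := by
        rw [← exp_add]; congr 1; push_cast; ring
      rw [this]
      have := exp_pos s
      have := exp_pos t
      nlinarith)
  have h' := ENNReal.toReal_mono (by finiteness) h
  rw [ENNReal.toReal_mul, ENNReal.toReal_pow] at h'
  change μ.real _ * μ.real _ ≤ μ.real _ ^ 2 at h'
  have he : exp ((s + t) / 2) ^ 2 = exp s * exp t := by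
    rw [← exp_nat_mul, ← exp_add]; congr 1; push_cast; ring
  rw [mul_pow, he]
  calc _ = exp s * exp t * (μ.real {x | exp s < p x} * μ.real {x | exp t < q x}) := by ring
    _ ≤ _ := by gcongr

lemma integrable_mul_log {α : Type*} [MeasurableSpace α] (μ : Measure α) (p : α → ℝ)
    (hp : Measurable p) (hp0 : ∀ x, 0 ≤ p x) (h1 : Integrable (fun x => √(p x)) μ)
    (h2 : Integrable (fun x => p x ^ 2) μ) : Integrable (fun x => p x * log (p x)) μ := by
  refine (h2.add (h1.const_mul 2)).mono' (by fun_prop) (.of_forall fun x => ?_)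
  simp only [Pi.add_apply, norm_mul, norm_eq_abs, abs_of_nonneg (hp0 x)]
  rcases (hp0 x).eq_or_lt with h | h
  · simp [← h]
  by_cases hx : 1 ≤ p x
  · rw [abs_of_nonneg (log_nonneg hx)]
    have := log_le_sub_one_of_pos h
    nlinarith [sqrt_nonneg (p x)]
  · push Not at hx
    rw [abs_of_nonpos (log_nonpos h.le hx.le)]
    have hs : 0 < √(p x) := sqrt_pos.mpr h
    have h3 := log_le_sub_one_of_pos (inv_pos.mpr hs)
    rw [log_inv, log_sqrt h.le] at h3
    have h4 : -log (p x) ≤ 2 * (√(p x))⁻¹ := by linarith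
    have h5 : p x * (2 * (√(p x))⁻¹) = 2 * √(p x) := by
      have := Real.sq_sqrt h.le
      field_simp
      linarith
    nlinarith [sq_nonneg (p x)]

lemma ent_bound {d : ℕ} (g : (Fin d → ℝ) → ℝ) (hg0 : ∀ x, 0 ≤ g x)
    (hgi : Integrable g) (hg1 : ∫ x, g x = 1) (hlog : Integrable fun x => g x * log (g x))
    (c : ℝ) (hc : 0 < c)
    (H : ∀ n : ℕ, 1 ≤ n → ∀ᵐ z, g z ^ (2 ^ n - 1) * c ≤ g ((1 - (1 / 2 : ℝ) ^ n) • z) ^ (2 ^ n)) :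
    log c - ∫ x, g x * log (g x) ≤ d := by
  have key : ∀ n : ℕ, 1 ≤ n → (log c - ∫ x, g x * log (g x)) * (1 - (1 / 2 : ℝ) ^ n) ^ d ≤ d := by
    intro n hn
    set ε : ℝ := (1 / 2 : ℝ) ^ n with hε
    have hε0 : 0 < ε := by positivity
    have hε1 : ε < 1 := pow_lt_one₀ (by norm_num) (by norm_num) (by omega)
    have hε2 : ε * 2 ^ n = 1 := by rw [hε, ← mul_pow]; norm_num
    have hpt : ∀ᵐ z, g z + ε * (log c * g z - g z * log (g z)) ≤ g ((1 - ε) • z) := by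
      filter_upwards [H n hn] with z hz
      rcases (hg0 z).eq_or_lt with h | h
      · simp only [← h]; simpa using hg0 _
      set t := g ((1 - ε) • z)
      have ht0 : 0 < t := by
        rcases (hg0 ((1 - ε) • z)).eq_or_lt with h' | h'
        · exfalso
          change 0 = t at h'
          rw [← h', zero_pow (by positivity)] at hz
          have : 0 < g z ^ (2 ^ n - 1) * c := by positivity
          linarith
        · exact h'
      have hl := log_le_log (by positivity) hz
      rw [log_mul (by positivity) hc.ne', log_pow, log_pow, Nat.cast_sub Nat.one_le_two_pow] at hl
      push_cast at hl
      have h6 : log (g z) + ε * (log c - log (g z)) ≤ log t := by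
        have := mul_le_mul_of_nonneg_left hl hε0.le
        have e1 : ε * ((2 ^ n - 1) * log (g z) + log c) =
          (ε * 2 ^ n) * log (g z) + ε * (log c - log (g z)) := by ring
        have e2 : ε * (2 ^ n * log t) = (ε * 2 ^ n) * log t := by ring
        rw [e1, e2, hε2] at this
        linarith
      have h7 := exp_le_exp.mpr h6
      rw [exp_add, exp_log h, exp_log ht0] at h7
      have h8 := add_one_le_exp (ε * (log c - log (g z)))
      nlinarith
    have hi : Integrable fun z => g ((1 - ε) • z) := hgi.comp_smul (by linarith)
    have hI : Integrable fun z => ε * (log c * g z - g z * log (g z)) :=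
      ((hgi.const_mul (log c)).sub hlog).const_mul ε
    have hint := integral_mono_ae (hgi.add hI) hi hpt
    rw [Measure.integral_comp_smul, hg1] at hint
    simp only [Pi.add_apply] at hint
    rw [integral_add hgi hI, integral_const_mul,
      integral_sub (hgi.const_mul (log c)) hlog, integral_const_mul, hg1] at hint
    have hl0 : 0 < (1 - ε) ^ d := pow_pos (by linarith) _
    simp only [Module.finrank_fin_fun, smul_eq_mul, mul_one, abs_inv, abs_of_pos hl0] at hint
    have hb := one_add_mul_le_pow (show -2 ≤ -ε by linarith) d
    rw [show 1 + -ε = 1 - ε by ring] at hb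
    set L := log c - ∫ x, g x * log (g x)
    have h9 := mul_le_mul_of_nonneg_right hint hl0.le
    rw [inv_mul_cancel₀ hl0.ne'] at h9
    have h10 : ε * (L * (1 - ε) ^ d) ≤ ε * d := by nlinarith
    exact le_of_mul_le_mul_left h10 hε0
  have hlim : Filter.Tendsto (fun n : ℕ => (log c - ∫ x, g x * log (g x)) * (1 - (1 / 2 : ℝ) ^ n) ^ d)
      Filter.atTop (nhds ((log c - ∫ x, g x * log (g x)) * (1 - 0) ^ d)) :=
    (((tendsto_pow_atTop_nhds_zero_of_lt_one (by norm_num) (by norm_num)).const_sub 1).pow d).const_mul _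
  have := le_of_tendsto hlim (Filter.eventually_atTop.mpr ⟨1, key⟩)
  simpa using this

lemma jensen_log {d : ℕ} (f : (Fin d → ℝ) → ℝ) (hf0 : ∀ x, 0 ≤ f x)
    (hfi : Integrable f) (hf1 : ∫ x, f x = 1) (hlog : Integrable fun x => f x * log (f x))
    (h2 : Integrable fun x => f x ^ 2) (hS : 0 < ∫ x, f x ^ 2) :
    ∫ x, f x * log (f x) ≤ log (∫ x, f x ^ 2) := by
  set S := ∫ x, f x ^ 2 with hSdef
  have h : ∫ x, f x * log (f x) ≤ ∫ x, ((log S - 1) * f x + S⁻¹ * f x ^ 2) := by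
    refine integral_mono hlog ((hfi.const_mul _).add (h2.const_mul _)) fun x => ?_
    rcases (hf0 x).eq_or_lt with h | h
    · simp [← h]
    have h3 := log_le_sub_one_of_pos (mul_pos (inv_pos.mpr hS) h)
    rw [log_mul (by positivity) h.ne', log_inv] at h3
    simp only
    nlinarith
  rw [integral_add (hfi.const_mul _) (h2.const_mul _), integral_const_mul, integral_const_mul, hf1,
    ← hSdef, inv_mul_cancel₀ hS.ne'] at h
  linarith

lemma ae_affine {d : ℕ} (p : (Fin d → ℝ) → Prop) (hp : ∀ᵐ x, p x) (a : ℝ) (ha : a ≠ 0)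
    (b : Fin d → ℝ) : ∀ᵐ z, p (a • (z + b)) := by
  rw [ae_iff] at hp ⊢
  have : {z | ¬ p (a • (z + b))} = (fun z => z + b) ⁻¹' ((fun z => a • z) ⁻¹' {x | ¬ p x}) := rfl
  rw [this, measure_preimage_add_right, Measure.addHaar_preimage_smul _ ha, hp, mul_zero]

/-- Radii shrinking to zero. -/
def rad (k : ℕ) : ℝ := 1 / ((k : ℝ) + 1)

lemma rad_pos (k : ℕ) : 0 < rad k := by unfold rad; positivity

lemma rad_tendsto : Filter.Tendsto rad Filter.atTop (nhdsWithin 0 (Set.Ioi 0)) :=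
  tendsto_nhdsWithin_iff.mpr ⟨tendsto_one_div_add_atTop_nhds_zero_nat, .of_forall rad_pos⟩

/-- Averaged density of a measure at scale `rad k`. -/
def avg {d : ℕ} (ρ : Measure (Fin d → ℝ)) (k : ℕ) (x : Fin d → ℝ) : ℝ≥0∞ :=
  ρ (Metric.closedBall x (rad k)) / volume (Metric.closedBall (0 : Fin d → ℝ) (rad k))

lemma vol_ne_zero {d : ℕ} (k : ℕ) : volume (Metric.closedBall (0 : Fin d → ℝ) (rad k)) ≠ 0 :=
  (Metric.measure_closedBall_pos _ _ (rad_pos k)).ne'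

lemma vol_ne_top {d : ℕ} (k : ℕ) : volume (Metric.closedBall (0 : Fin d → ℝ) (rad k)) ≠ ∞ :=
  measure_closedBall_lt_top.ne

lemma avg_tendsto {d : ℕ} (p : (Fin d → ℝ) → ℝ) (hp : Measurable p)
    (ρ : Measure (Fin d → ℝ)) [IsProbabilityMeasure ρ]
    (hρ : ρ = volume.withDensity (fun x => ENNReal.ofReal (p x))) :
    ∀ᵐ x, Filter.Tendsto (fun k => avg ρ k x) Filter.atTop (nhds (ENNReal.ofReal (p x))) := by
  have h1 := Besicovitch.ae_tendsto_rnDeriv ρ (volume : Measure (Fin d → ℝ))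
  have h2 := Measure.rnDeriv_withDensity (volume : Measure (Fin d → ℝ)) hp.ennreal_ofReal
  rw [← hρ] at h2
  filter_upwards [h1, h2] with x hx1 hx2
  rw [hx2] at hx1
  refine (hx1.comp rad_tendsto).congr fun k => ?_
  simp only [Function.comp, avg]
  rw [Measure.addHaar_closedBall_center volume x]

lemma avg_mid {d : ℕ} (ρ : Measure (Fin d → ℝ)) (k : ℕ) (x y z : Fin d → ℝ)
    (h : ρ (Metric.closedBall x (rad k)) * ρ (Metric.closedBall y (rad k)) ≤
      ρ (Metric.closedBall z (rad k)) ^ 2) :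
    avg ρ k x * avg ρ k y ≤ avg ρ k z ^ 2 := by
  unfold avg
  simp only [div_eq_mul_inv, mul_pow]
  calc _ = ρ (Metric.closedBall x (rad k)) * ρ (Metric.closedBall y (rad k)) *
        (volume (Metric.closedBall (0 : Fin d → ℝ) (rad k)))⁻¹ ^ 2 := by ring
    _ ≤ _ := by gcongr

/-- Iterating the midpoint inequality towards `1`. -/
lemma dyadic {d : ℕ} (N : (Fin d → ℝ) → ℝ≥0∞)
    (hN : ∀ x y, N x * N y ≤ N ((1 / 2 : ℝ) • (x + y)) ^ 2) (z : Fin d → ℝ) (n : ℕ) :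
    N z ^ (2 ^ n - 1) * N 0 ≤ N ((1 - (1 / 2 : ℝ) ^ n) • z) ^ (2 ^ n) := by
  induction n with
  | zero => simp
  | succ n ih =>
    have e : (1 - (1 / 2 : ℝ) ^ (n + 1)) • z =
        (1 / 2 : ℝ) • ((1 - (1 / 2 : ℝ) ^ n) • z + z) := by
      rw [smul_add, smul_smul, ← add_smul]; congr 1; ring
    rw [e]
    have h1 : 2 ^ (n + 1) - 1 = (2 ^ n - 1) + 2 ^ n := by
      have : 1 ≤ 2 ^ n := Nat.one_le_two_pow
      rw [pow_succ]; omega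
    calc N z ^ (2 ^ (n + 1) - 1) * N 0 = (N z ^ (2 ^ n - 1) * N 0) * N z ^ 2 ^ n := by
          rw [h1, pow_add]; ring
      _ ≤ N ((1 - (1 / 2 : ℝ) ^ n) • z) ^ (2 ^ n) * N z ^ 2 ^ n := by gcongr
      _ = (N ((1 - (1 / 2 : ℝ) ^ n) • z) * N z) ^ 2 ^ n := by rw [mul_pow]
      _ ≤ (N ((1 / 2 : ℝ) • ((1 - (1 / 2 : ℝ) ^ n) • z + z)) ^ 2) ^ 2 ^ n := by gcongr; exact hN _ _
      _ = _ := by rw [← pow_mul, pow_succ, mul_comm 2]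

lemma ball_mid {E : Type*} [NormedAddCommGroup E] [NormedSpace ℝ E] (x y a b : E) (r : ℝ)
    (ha : a ∈ Metric.closedBall x r) (hb : b ∈ Metric.closedBall y r) :
    (1 / 2 : ℝ) • (a + b) ∈ Metric.closedBall ((1 / 2 : ℝ) • (x + y)) r := by
  rw [mem_closedBall_iff_norm] at *
  rw [← smul_sub, norm_smul, add_sub_add_comm]
  have := norm_add_le (a - x) (b - y)
  norm_num
  linarith

section Main

variable {d : ℕ} (μ ν : Measure (Fin d → ℝ)) [IsProbabilityMeasure μ] [IsProbabilityMeasure ν]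

lemma nu_ball (hν : ν = (μ.prod μ).map (fun q => q.1 - q.2)) (z : Fin d → ℝ) (r : ℝ) :
    ν (Metric.closedBall z r) = ∫⁻ y, ENNReal.ofReal (μ.real (Metric.closedBall (y + z) r)) ∂μ := by
  rw [hν, Measure.map_apply (by fun_prop) measurableSet_closedBall,
    Measure.prod_apply_symm ((by fun_prop : Measurable fun q : (Fin d → ℝ) × (Fin d → ℝ) =>
      q.1 - q.2) measurableSet_closedBall)]
  congr with y
  rw [ofReal_measureReal]
  congr 1
  ext x
  simp only [Set.mem_preimage, mem_closedBall_iff_norm]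
  rw [sub_sub]

lemma nu_mid (hν : ν = (μ.prod μ).map (fun q => q.1 - q.2))
    (hμ : ∀ A B C : Set (Fin d → ℝ), MeasurableSet A → MeasurableSet B →
      (∀ x ∈ A, ∀ y ∈ B, (1 / 2 : ℝ) • (x + y) ∈ C) → μ A * μ B ≤ μ C ^ 2)
    (z w : Fin d → ℝ) (r : ℝ) :
    ν (Metric.closedBall z r) * ν (Metric.closedBall w r) ≤
      ν (Metric.closedBall ((1 / 2 : ℝ) • (z + w)) r) ^ 2 := by
  have hm : Measurable fun x => μ.real (Metric.closedBall x r) := by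
    have h : MeasurableSet {q : (Fin d → ℝ) × (Fin d → ℝ) | dist q.2 q.1 ≤ r} :=
      measurableSet_le (by fun_prop) measurable_const
    exact (measurable_measure_prodMk_left h).ennreal_toReal
  rw [nu_ball μ ν hν, nu_ball μ ν hν, nu_ball μ ν hν]
  refine pl_measure μ hμ (fun y => μ.real (Metric.closedBall (y + z) r))
    (fun y => μ.real (Metric.closedBall (y + w) r))
    (fun y => μ.real (Metric.closedBall (y + (1 / 2 : ℝ) • (z + w)) r))
    (hm.comp (measurable_add_const z)) (hm.comp (measurable_add_const w))
    (hm.comp (measurable_add_const _))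
    (fun _ => measureReal_nonneg) (fun _ => measureReal_nonneg) (fun _ => measureReal_nonneg)
    (fun _ => measureReal_le_one) (fun _ => measureReal_le_one) ?_
  intro x y
  have h := hμ (Metric.closedBall (x + z) r) (Metric.closedBall (y + w) r) _
    measurableSet_closedBall measurableSet_closedBall (fun a ha b hb => ball_mid _ _ a b r ha hb)
  have h' := ENNReal.toReal_mono (by finiteness) h
  rw [ENNReal.toReal_mul, ENNReal.toReal_pow] at h'
  have e : (1 / 2 : ℝ) • (x + y) + (1 / 2 : ℝ) • (z + w) = (1 / 2 : ℝ) • (x + z + (y + w)) := by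
    rw [← smul_add]; congr 1; abel
  rw [e]
  exact h'

lemma nu_symm (hν : ν = (μ.prod μ).map (fun q => q.1 - q.2)) (z : Fin d → ℝ) (r : ℝ) :
    ν (Metric.closedBall (-z) r) = ν (Metric.closedBall z r) := by
  have h1 : ν = (μ.prod μ).map (fun q => q.2 - q.1) := by
    conv_lhs => rw [hν, ← Measure.prod_swap, Measure.map_map (by fun_prop) measurable_swap]
    rfl
  conv_lhs => rw [h1, Measure.map_apply (by fun_prop) measurableSet_closedBall]
  conv_rhs => rw [hν, Measure.map_apply (by fun_prop) measurableSet_closedBall]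
  congr 1
  ext q
  simp only [Set.mem_preimage, mem_closedBall_iff_norm]
  rw [← norm_neg]
  congr! 2
  abel

lemma nu_le_zero (hν : ν = (μ.prod μ).map (fun q => q.1 - q.2))
    (hμ : ∀ A B C : Set (Fin d → ℝ), MeasurableSet A → MeasurableSet B →
      (∀ x ∈ A, ∀ y ∈ B, (1 / 2 : ℝ) • (x + y) ∈ C) → μ A * μ B ≤ μ C ^ 2)
    (z : Fin d → ℝ) (r : ℝ) :
    ν (Metric.closedBall z r) ≤ ν (Metric.closedBall 0 r) := by
  have h := nu_mid μ ν hν hμ z (-z) r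
  rw [nu_symm μ ν hν, add_neg_cancel, smul_zero, ← sq] at h
  exact (ENNReal.pow_le_pow_left_iff two_ne_zero).mp h

lemma density_facts (p : (Fin d → ℝ) → ℝ) (hp : Measurable p) (hp0 : ∀ x, 0 ≤ p x)
    (hρ : μ = volume.withDensity (fun x => ENNReal.ofReal (p x))) :
    Integrable p ∧ ∫ x, p x = 1 := by
  have h1 : ∫⁻ x, ENNReal.ofReal (p x) = 1 := by
    have := measure_univ (μ := μ)
    rwa [hρ, withDensity_apply _ MeasurableSet.univ, setLIntegral_univ] at this
  constructor
  · refine ⟨hp.aestronglyMeasurable, ?_⟩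
    rw [hasFiniteIntegral_iff_ofReal (.of_forall hp0), h1]
    exact ENNReal.one_lt_top
  · rw [integral_eq_lintegral_of_nonneg_ae (.of_forall hp0) hp.aestronglyMeasurable, h1]
    simp

lemma sqrt_int (p : (Fin d → ℝ) → ℝ) (hp : Measurable p) (hp0 : ∀ x, 0 ≤ p x)
    (hpi : Integrable p) (c : ℝ) (hc : 0 < c) (b : Fin d → ℝ)
    (h : ∀ᵐ z, p z * c ≤ p ((1 / 2 : ℝ) • (z + b)) ^ 2) :
    Integrable (fun z => √(p z)) := by
  have hi : Integrable fun z => p ((1 / 2 : ℝ) • (z + b)) :=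
    (hpi.comp_smul (by norm_num : (1 / 2 : ℝ) ≠ 0)).comp_add_right b
  refine (hi.const_mul (√c)⁻¹).mono' (by fun_prop) ?_
  filter_upwards [h] with z hz
  rw [norm_of_nonneg (sqrt_nonneg _), le_inv_mul_iff₀ (sqrt_pos.mpr hc), ← sqrt_mul hc.le, mul_comm]
  exact sqrt_le_iff.mpr ⟨hp0 _, hz⟩

lemma entropy_main (hν : ν = (μ.prod μ).map (fun q => q.1 - q.2))
    (hμ : ∀ A B C : Set (Fin d → ℝ), MeasurableSet A → MeasurableSet B →
      (∀ x ∈ A, ∀ y ∈ B, (1 / 2 : ℝ) • (x + y) ∈ C) → μ A * μ B ≤ μ C ^ 2)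
    (f g : (Fin d → ℝ) → ℝ) (hf : Measurable f) (hf0 : ∀ x, 0 ≤ f x)
    (hfμ : μ = volume.withDensity (fun x => ENNReal.ofReal (f x)))
    (hg : Measurable g) (hg0 : ∀ x, 0 ≤ g x)
    (hgν : ν = volume.withDensity (fun x => ENNReal.ofReal (g x))) :
    -∫ x, g x * log (g x) ≤ d + -∫ x, f x * log (f x) := by
  obtain ⟨hfi, hf1⟩ := density_facts μ f hf hf0 hfμ
  obtain ⟨hgi, hg1⟩ := density_facts ν g hg hg0 hgν
  have hfl := avg_tendsto f hf μ hfμ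
  have hgl := avg_tendsto g hg ν hgν
  have exists_pos : ∀ p : (Fin d → ℝ) → ℝ, (∀ x, 0 ≤ p x) → ∫ x, p x = 1 →
      ∀ q : (Fin d → ℝ) → Prop, (∀ᵐ x, q x) → ∃ x, 0 < p x ∧ q x := by
    intro p hp0 hp1 q hq
    by_contra! hcon
    have : p =ᵐ[volume] 0 := by
      filter_upwards [hq] with x hx
      rcases (hp0 x).eq_or_lt with h | h
      · exact h.symm
      · exact absurd hx (hcon x h)
    rw [integral_congr_ae this] at hp1
    simp at hp1
  -- square root of f
  obtain ⟨x0, hx0, hx0l⟩ := exists_pos f hf0 hf1 _ hfl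
  have hfmid : ∀ᵐ z, f z * f x0 ≤ f ((1 / 2 : ℝ) • (z + x0)) ^ 2 := by
    filter_upwards [hfl, ae_affine _ hfl (1 / 2) (by norm_num) x0] with z hz1 hz2
    have h := le_of_tendsto_of_tendsto'
      (ENNReal.Tendsto.mul hz1 (Or.inr ENNReal.ofReal_ne_top) hx0l (Or.inr ENNReal.ofReal_ne_top))
      (ENNReal.Tendsto.pow (n := 2) hz2) (fun k => avg_mid μ k z x0 _ (hμ _ _ _ measurableSet_closedBall
        measurableSet_closedBall (fun a ha b hb => ball_mid _ _ a b _ ha hb)))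
    rw [← ENNReal.ofReal_mul (hf0 z), ← ENNReal.ofReal_pow (hf0 _)] at h
    exact (ENNReal.ofReal_le_ofReal_iff (by positivity)).mp h
  have hfs : Integrable fun z => √(f z) := sqrt_int f hf hf0 hfi (f x0) hx0 x0 hfmid
  -- the value at the origin
  set M : ℝ≥0∞ := Filter.liminf (fun k => avg ν k 0) Filter.atTop with hM
  have hgM : ∀ᵐ z, ENNReal.ofReal (g z) ≤ M := by
    filter_upwards [hgl] with z hz
    rw [← hz.liminf_eq]
    refine Filter.liminf_le_liminf (.of_forall fun k => ?_)
    exact ENNReal.div_le_div_right (nu_le_zero μ ν hν hμ z _) _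
  have hSM : ∫⁻ x, ENNReal.ofReal (f x ^ 2) ≤ M := by
    have h1 : ∀ k, avg ν k 0 = ∫⁻ y, avg μ k y ∂μ := by
      intro k
      unfold avg
      simp only [div_eq_mul_inv]
      rw [lintegral_mul_const' _ _ (by simpa using vol_ne_zero k), nu_ball μ ν hν]
      simp
    have h2 : ∫⁻ x, ENNReal.ofReal (f x ^ 2) = ∫⁻ x, ENNReal.ofReal (f x) ∂μ := by
      conv_rhs => rw [hfμ]
      rw [lintegral_withDensity_eq_lintegral_mul _ hf.ennreal_ofReal hf.ennreal_ofReal]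
      congr with x
      simp [ENNReal.ofReal_mul (hf0 x), sq]
    have hac : μ ≪ volume := by
      conv_lhs => rw [hfμ]
      exact withDensity_absolutelyContinuous _ _
    have h3 : ∫⁻ x, ENNReal.ofReal (f x) ∂μ =
        ∫⁻ x, Filter.liminf (fun k => avg μ k x) Filter.atTop ∂μ := by
      refine lintegral_congr_ae ?_
      filter_upwards [hac.ae_le hfl] with x hx
      exact hx.liminf_eq.symm
    have hmeas : ∀ k, Measurable fun x => avg μ k x := by
      intro k
      have h : MeasurableSet {q : (Fin d → ℝ) × (Fin d → ℝ) | dist q.2 q.1 ≤ rad k} :=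
        measurableSet_le (by fun_prop) measurable_const
      exact (measurable_measure_prodMk_left h).div_const _
    rw [h2, h3, hM]
    simp only [h1]
    exact lintegral_liminf_le hmeas
  have hgdy : ∀ c : ℝ, 0 < c → ENNReal.ofReal c < M → ∀ n : ℕ, 1 ≤ n →
      ∀ᵐ z, g z ^ (2 ^ n - 1) * c ≤ g ((1 - (1 / 2 : ℝ) ^ n) • z) ^ (2 ^ n) := by
    intro c hc hcM n hn
    have hn1 : 1 - (1 / 2 : ℝ) ^ n ≠ 0 := by
      have : (1 / 2 : ℝ) ^ n < 1 := pow_lt_one₀ (by norm_num) (by norm_num) (by omega)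
      linarith
    have haff := ae_affine _ hgl _ hn1 0
    filter_upwards [hgl, haff] with z hz1 hz2
    rw [add_zero] at hz2
    have h := le_of_tendsto_of_tendsto
      (ENNReal.Tendsto.mul_const (b := ENNReal.ofReal c) (ENNReal.Tendsto.pow (n := 2 ^ n - 1) hz1) (Or.inr ENNReal.ofReal_ne_top))
      (ENNReal.Tendsto.pow (n := 2 ^ n) hz2) (by
        filter_upwards [Filter.eventually_lt_of_lt_liminf hcM] with k hk
        refine le_trans ?_ (dyadic (fun x => avg ν k x)
          (fun x y => avg_mid ν k x y _ (nu_mid μ ν hν hμ x y _)) z n)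
        gcongr)
    rw [← ENNReal.ofReal_pow (hg0 _), ← ENNReal.ofReal_pow (hg0 _),
      ← ENNReal.ofReal_mul (pow_nonneg (hg0 _) _)] at h
    exact (ENNReal.ofReal_le_ofReal_iff (pow_nonneg (hg0 _) _)).mp h
  have hghalf : ∀ c : ℝ, 0 < c → ENNReal.ofReal c < M →
      ∀ᵐ z, g z * c ≤ g ((1 / 2 : ℝ) • (z + 0)) ^ 2 := by
    intro c hc hcM
    filter_upwards [hgdy c hc hcM 1 le_rfl] with z hz
    norm_num at hz ⊢
    exact hz
  have hMpos : 0 < M := by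
    obtain ⟨x, hx, hxM⟩ := exists_pos g hg0 hg1 _ hgM
    exact lt_of_lt_of_le (ENNReal.ofReal_pos.mpr hx) hxM
  have exists_c : ∃ c : ℝ, 0 < c ∧ ENNReal.ofReal c < M := by
    obtain ⟨c, hc1, hc2⟩ := exists_between hMpos
    lift c to NNReal using (ne_top_of_lt hc2)
    exact ⟨c, by exact_mod_cast hc1, by simpa using hc2⟩
  obtain ⟨c0, hc0, hc0M⟩ := exists_c
  have hgs : Integrable fun z => √(g z) := sqrt_int g hg hg0 hgi c0 hc0 0 (hghalf c0 hc0 hc0M)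
  set J := ∫ z, √(g z) with hJ
  have hJpos : 0 < J := by
    rw [hJ, integral_pos_iff_support_of_nonneg (fun _ => sqrt_nonneg _) hgs]
    by_contra hcon
    have hz : volume (Function.support fun z => √(g z)) = 0 := by simpa using hcon
    have hq : ∀ᵐ z, √(g z) = 0 := by
      rw [ae_iff]; exact hz
    obtain ⟨x, hx, hx2⟩ := exists_pos g hg0 hg1 _ hq
    exact (sqrt_pos.mpr hx).ne' hx2
  have hcK : ∀ c : ℝ, 0 < c → ENNReal.ofReal c < M → c ≤ (2 ^ d / J) ^ 2 := by
    intro c hc hcM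
    have hi : Integrable fun z => g ((1 / 2 : ℝ) • z) :=
      hgi.comp_smul (by norm_num : (1 / 2 : ℝ) ≠ 0)
    have h := integral_mono_ae (hgs.const_mul (√c)) hi (by
      filter_upwards [hghalf c hc hcM] with z hz
      rw [add_zero] at hz
      rw [← sqrt_mul hc.le, mul_comm]
      exact sqrt_le_iff.mpr ⟨hg0 _, hz⟩)
    rw [integral_const_mul, Measure.integral_comp_smul, hg1] at h
    simp only [Module.finrank_fin_fun, smul_eq_mul, mul_one] at h
    have e : |((1 / 2 : ℝ) ^ d)⁻¹| = 2 ^ d := by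
      rw [abs_of_pos (by positivity), one_div, inv_pow, inv_inv]
    rw [e, ← le_div_iff₀ hJpos] at h
    exact (sqrt_le_left (by positivity)).mp h
  have hMK : M ≤ ENNReal.ofReal ((2 ^ d / J) ^ 2) := by
    refine le_of_forall_lt fun a ha => ?_
    obtain ⟨b, hab, hbM⟩ := exists_between ha
    lift b to NNReal using (ne_top_of_lt hbM)
    have hb0 : (0:ℝ) < b := by
      have : (0 : ℝ≥0∞) < b := lt_of_le_of_lt bot_le hab
      exact_mod_cast this
    refine lt_of_lt_of_le hab ?_
    have := ENNReal.ofReal_le_ofReal (hcK b hb0 (by simpa using hbM))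
    simpa using this
  set K := (2 ^ d / J) ^ 2 with hK
  have hK0 : 0 ≤ K := sq_nonneg _
  -- integrability
  have hg2 : Integrable fun z => g z ^ 2 := by
    refine (hgi.const_mul K).mono' (by fun_prop) ?_
    filter_upwards [hgM] with z hz
    have : g z ≤ K := (ENNReal.ofReal_le_ofReal_iff hK0).mp (hz.trans hMK)
    rw [norm_of_nonneg (by positivity)]
    nlinarith [hg0 z]
  have hf2 : Integrable fun z => f z ^ 2 := by
    refine ⟨by fun_prop, ?_⟩
    rw [hasFiniteIntegral_iff_ofReal (.of_forall fun z => by positivity)]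
    exact lt_of_le_of_lt (hSM.trans hMK) ENNReal.ofReal_lt_top
  have hglog := integrable_mul_log volume g hg hg0 hgs hg2
  have hflog := integrable_mul_log volume f hf hf0 hfs hf2
  have hS : 0 < ∫ x, f x ^ 2 := by
    rw [integral_pos_iff_support_of_nonneg (fun _ => sq_nonneg _) hf2]
    by_contra hcon
    have hz : volume (Function.support fun z => f z ^ 2) = 0 := by simpa using hcon
    have hq : ∀ᵐ z, f z ^ 2 = 0 := by
      rw [ae_iff]; exact hz
    obtain ⟨x, hx, hx2⟩ := exists_pos f hf0 hf1 _ hq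
    exact (pow_pos hx 2).ne' hx2
  have hj := jensen_log f hf0 hfi hf1 hflog hf2 hS
  have hSM' : ENNReal.ofReal (∫ x, f x ^ 2) ≤ M := by
    rwa [ofReal_integral_eq_lintegral_ofReal hf2 (.of_forall fun z => sq_nonneg _)]
  set S := ∫ x, f x ^ 2 with hSdef
  have hfin : S ≤ exp (d + ∫ x, g x * log (g x)) := by
    refine le_of_forall_lt fun a ha => ?_
    obtain ⟨b, hab, hbS⟩ := exists_between (max_lt ha hS)
    have hb0 : 0 < b := lt_of_le_of_lt (le_max_right _ _) hab
    have hbM : ENNReal.ofReal b < M :=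
      lt_of_lt_of_le ((ENNReal.ofReal_lt_ofReal_iff hS).mpr hbS) hSM'
    have h := ent_bound g hg0 hgi hg1 hglog b hb0 (hgdy b hb0 hbM)
    refine lt_of_lt_of_le (lt_of_le_of_lt (le_max_left _ _) hab) ?_
    rw [← log_le_iff_le_exp hb0]
    linarith
  rw [← log_le_iff_le_exp hS] at hfin
  linarith

end Main

/-- If the product measure is `κ`-concave, then the marginal is midpoint log-concave. -/
lemma midpoint_of_kappa {d : ℕ} (μ : Measure (Fin d → ℝ)) [IsProbabilityMeasure μ]
    (κ : ℝ) (hκ : κ < 0)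
    (h : ∀ A B : Set ((Fin d → ℝ) × (Fin d → ℝ)), MeasurableSet A → MeasurableSet B →
      ∀ t : ℝ, t ∈ Set.Icc (0:ℝ) 1 →
      genMean κ t ((μ.prod μ) A).toReal ((μ.prod μ) B).toReal ≤
        ((μ.prod μ) ((1 - t) • A + t • B)).toReal) :
    ∀ A B C : Set (Fin d → ℝ), MeasurableSet A → MeasurableSet B →
      (∀ x ∈ A, ∀ y ∈ B, (1 / 2 : ℝ) • (x + y) ∈ C) → μ A * μ B ≤ μ C ^ 2 := by
  intro A B C hA hB hC
  have h1 := h (A ×ˢ B) (B ×ˢ A) (hA.prod hB) (hB.prod hA) (1 / 2) (by constructor <;> norm_num)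
  have hsub : ((1 - 1 / 2 : ℝ) • (A ×ˢ B) + (1 / 2 : ℝ) • (B ×ˢ A)) ⊆ C ×ˢ C := by
    rintro _ ⟨_, ⟨⟨a, b⟩, ⟨ha, hb⟩, rfl⟩, _, ⟨⟨b', a'⟩, ⟨hb', ha'⟩, rfl⟩, rfl⟩
    have e : (1 - 1 / 2 : ℝ) = 1 / 2 := by norm_num
    simp only at ha hb ha' hb'
    constructor
    · have := hC a ha b' hb'
      simp only [e, Prod.smul_mk, Prod.mk_add_mk, ← smul_add]
      exact this
    · have := hC a' ha' b hb
      simp only [e, Prod.smul_mk, Prod.mk_add_mk, ← smul_add]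
      rwa [add_comm]
  have h2 : ((μ.prod μ) ((1 - 1 / 2 : ℝ) • (A ×ˢ B) + (1 / 2 : ℝ) • (B ×ˢ A))).toReal ≤
      ((μ.prod μ) (C ×ˢ C)).toReal :=
    ENNReal.toReal_mono (by finiteness) (measure_mono hsub)
  have h3 := h1.trans h2
  rw [Measure.prod_prod, Measure.prod_prod, Measure.prod_prod, mul_comm (μ B)] at h3
  have hm : genMean κ (1 / 2) (μ A * μ B).toReal (μ A * μ B).toReal = (μ A * μ B).toReal := by
    have hnn : 0 ≤ (μ A * μ B).toReal := ENNReal.toReal_nonneg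
    generalize (μ A * μ B).toReal = a at hnn
    have hκ0 : (κ : EReal) ≠ 0 := by exact_mod_cast hκ.ne
    unfold genMean
    rw [if_neg (EReal.coe_ne_bot κ), if_neg (EReal.coe_ne_top κ), if_neg hκ0, EReal.toReal_coe]
    by_cases ha : a = 0
    · rw [if_pos ⟨hκ, Or.inl ha⟩, ha]
    · rw [if_neg (by simp [ha])]
      rw [← add_mul, sub_add_cancel, one_mul, ← Real.rpow_mul hnn, mul_one_div_cancel hκ.ne,
        Real.rpow_one]
  rw [hm] at h3
  rw [sq]
  exact (ENNReal.toReal_le_toReal (by finiteness) (by finiteness)).mp h3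

/-- Entropic Rogers–Shephard inequality for convex measures: if `(X,Y) ∈ ℝ^d × ℝ^d`
has a `κ`-concave joint distribution (`κ < 0`) with `X, Y` independent and identically
distributed, each with density `f`, then `N(X-Y) ≤ C_κ N(X)` with
`C_κ = exp((2/d)(1-dκ) ∑_{j=0}^{d-1} 1/(1-jκ))`. -/
theorem entropic_rogers_shephard {Ω : Type*} [MeasurableSpace Ω]
    {d : ℕ} (hd : 0 < d) (P : Measure Ω) [IsProbabilityMeasure P]
    (κ : ℝ) (hκ : κ < 0)
    (X Y : Ω → (Fin d → ℝ))
    (hconc : IsKappaConcave (κ : EReal) (Measure.map (fun ω => (X ω, Y ω)) P))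
    (hindep : IndepFun X Y P)
    (hident : Measure.map X P = Measure.map Y P)
    (f fD : (Fin d → ℝ) → ℝ)
    (hX : HasDensityFn P X f)
    (hD : HasDensityFn P (fun ω => X ω - Y ω) fD) :
    entropyPower d fD
      ≤ Real.exp ((2 / d) * (1 - d * κ) * ∑ j ∈ Finset.range d, 1 / (1 - j * κ))
          * entropyPower d f := by
  obtain ⟨hXm, hfm, hf0, hfμ⟩ := hX
  obtain ⟨hDm, hgm, hg0, hgν⟩ := hD
  have hYm : Measurable Y := by
    have h := hXm.sub hDm
    have e : X - (fun ω => X ω - Y ω) = Y := by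
      funext ω
      simp
    rwa [e] at h
  set μ := Measure.map X P with hμdef
  set ν := Measure.map (fun ω => X ω - Y ω) P with hνdef
  haveI : IsProbabilityMeasure μ := Measure.isProbabilityMeasure_map hXm.aemeasurable
  haveI : IsProbabilityMeasure ν := Measure.isProbabilityMeasure_map hDm.aemeasurable
  have hjoint : Measure.map (fun ω => (X ω, Y ω)) P = μ.prod μ := by
    rw [(indepFun_iff_map_prod_eq_prod_map_map hXm.aemeasurable hYm.aemeasurable).mp hindep,
      ← hident]
  rw [hjoint] at hconc
  have hν : ν = (μ.prod μ).map (fun q => q.1 - q.2) := by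
    rw [← hjoint, Measure.map_map (by fun_prop) (hXm.prodMk hYm)]
    rfl
  have hmain := entropy_main μ ν hν (midpoint_of_kappa μ κ hκ hconc.2) f fD hfm hf0 hfμ hgm hg0 hgν
  have hd' : (0 : ℝ) < d := by exact_mod_cast hd
  have hsum : (d : ℝ) ≤ (1 - d * κ) * ∑ j ∈ Finset.range d, 1 / (1 - j * κ) := by
    rw [Finset.mul_sum]
    calc (d : ℝ) = ∑ j ∈ Finset.range d, (1 : ℝ) := by simp
      _ ≤ _ := by
        refine Finset.sum_le_sum fun j hj => ?_
        have hj' : (j : ℝ) ≤ d := by exact_mod_cast (Finset.mem_range.mp hj).le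
        have hj0 : (0 : ℝ) ≤ j := Nat.cast_nonneg j
        have hpos : 0 < 1 - j * κ := by nlinarith
        rw [mul_one_div, le_div_iff₀ hpos]
        nlinarith
  unfold entropyPower shannonEntropy
  rw [← Real.exp_add, Real.exp_le_exp]
  set S := ∑ j ∈ Finset.range d, 1 / (1 - (j : ℝ) * κ)
  have e : 2 / (d : ℝ) * (1 - d * κ) * S + 2 * (-∫ x, f x * Real.log (f x)) / d =
      2 * ((1 - d * κ) * S + (-∫ x, f x * Real.log (f x))) / d := by
    field_simp
  rw [e]
  gcongr
  linarith
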